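/- Let A and B be G-rigid k-bialgebras with A generalized-primitively-generated, and let f: A → B be a morphism of G-rigid k-bialgebras. Then f is injective if and only if the induced map GP_*(A) → GP_*(B) on generalized primitives is injective. -/

import Mathlib

/-!
Statement 4: a morphism of `G`-rigid bialgebras out of a generalized-primitively-generated
one is injective iff it is injective on generalized primitives.
-/

open TensorProduct

section Defs

variable (k : Type*) {A B : Type*} [CommSemiring k] [Semiring A] [Semiring B]
variable [Bialgebra k A] [Bialgebra k B]

/-- An element `Q` of a `k`-bialgebra `A` is *grouplike* if `Δ Q = Q ⊗ Q` and `ε Q = 1`. -/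
def IsGrouplike (Q : A) : Prop :=
  Coalgebra.comul (R := k) Q = Q ⊗ₜ[k] Q ∧ Coalgebra.counit (R := k) Q = 1

/-- For `Q` a grouplike, `a` is a *`Q`-primitive* if `Δ a = a ⊗ Q + Q ⊗ a`. -/
def IsPrimitive (Q a : A) : Prop :=
  Coalgebra.comul (R := k) a = a ⊗ₜ[k] Q + Q ⊗ₜ[k] a

/-- The `k`-submodule of *generalized primitives* of `A`. -/
def genPrim (A : Type*) [Semiring A] [Bialgebra k A] : Submodule k A :=
  Submodule.span k {a : A | ∃ Q : A, IsGrouplike k Q ∧ IsPrimitive k Q a}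

/-- `A` is *generalized-primitively-generated* if it is generated, as a `k`-algebra, by its
grouplike elements together with its generalized primitives. -/
def GPGenerated (A : Type*) [Semiring A] [Bialgebra k A] : Prop :=
  Algebra.adjoin k ({a : A | IsGrouplike k a} ∪ (genPrim k A : Set A)) = ⊤

/-- An algebra morphism of bialgebras is a *bialgebra morphism* if it commutes with the
comultiplications and the counits. -/
def IsBialgHom (f : A →ₐ[k] B) : Prop :=
  (∀ a : A, Coalgebra.comul (R := k) (f a) =
      TensorProduct.map f.toLinearMap f.toLinearMap (Coalgebra.comul (R := k) a)) ∧
  (∀ a : A, Coalgebra.counit (R := k) (f a) = Coalgebra.counit (R := k) a)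

/-- A *`G`-rigid `k`-bialgebra* structure on `A`: a multiplicative map `η : G → A` whose
values are central grouplikes, and which is an isomorphism from `G` onto the monoid of
grouplikes of `A`.  (This is the monoid-level datum of a bialgebra map `kG → A` inducing an
isomorphism of `G` onto the grouplikes of `A`, with central image.) -/
structure RigidBialgebra (G : Type*) [CommMonoid G] (A : Type*) [Semiring A]
    [Bialgebra k A] where
  η : G →* A
  grouplike : ∀ g : G, IsGrouplike k (η g)
  central : ∀ (g : G) (a : A), η g * a = a * η g
  injective : Function.Injective η
  surjOn : ∀ a : A, IsGrouplike k a → ∃ g : G, η g = a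

end Defs

section PrimFiltration

open Submodule

variable {k A B : Type*} [Field k] [Ring A] [Bialgebra k A] [Ring B] [Bialgebra k B]

variable (k) in
/-- The map `a ↦ Δ a - a ⊗ Q - Q ⊗ a`, whose kernel consists of the `Q`-primitives. -/
noncomputable def reducedComul (Q : A) : A →ₗ[k] A ⊗[k] A :=
  Coalgebra.comul - (TensorProduct.mk k A A).flip Q - TensorProduct.mk k A A Q

variable (k) in
/-- The primitive filtration at `Q`: it starts at `0`, and an element lies in the next step when
its reduced comultiplication lies in the tensor square of the previous step. -/
noncomputable def primFiltration (Q : A) : ℕ → Submodule k A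
  | 0 => ⊥
  | n + 1 => (map₂ (TensorProduct.mk k A A) (primFiltration Q n)
      (primFiltration Q n)).comap (reducedComul k Q)

theorem reducedComul_apply (Q a : A) :
    reducedComul k Q a = Coalgebra.comul a - a ⊗ₜ[k] Q - Q ⊗ₜ[k] a := rfl

theorem comul_eq_reducedComul_add (Q a : A) :
    Coalgebra.comul a = reducedComul k Q a + a ⊗ₜ[k] Q + Q ⊗ₜ[k] a := by
  rw [reducedComul_apply]; abel

theorem isPrimitive_iff_reducedComul_eq_zero {Q a : A} :
    IsPrimitive k Q a ↔ reducedComul k Q a = 0 := by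
  rw [reducedComul_apply, sub_sub, sub_eq_zero, IsPrimitive]

theorem mem_primFiltration_succ {Q a : A} {n : ℕ} :
    a ∈ primFiltration k Q (n + 1) ↔ reducedComul k Q a ∈
      map₂ (TensorProduct.mk k A A) (primFiltration k Q n) (primFiltration k Q n) := Iff.rfl

theorem primFiltration_mono (Q : A) : Monotone (primFiltration k Q) := by
  refine monotone_nat_of_le_succ fun n => ?_
  induction n with
  | zero => exact bot_le
  | succ n ih => exact comap_mono (map₂_le_map₂ ih ih)

theorem IsPrimitive.mem_primFiltration_one {Q a : A} (h : IsPrimitive k Q a) :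
    a ∈ primFiltration k Q 1 := by
  rw [mem_primFiltration_succ, isPrimitive_iff_reducedComul_eq_zero.1 h]
  exact zero_mem _

theorem IsGrouplike.mul {P Q : A} (hP : IsGrouplike k P) (hQ : IsGrouplike k Q) :
    IsGrouplike k (P * Q) := by
  refine ⟨?_, ?_⟩
  · rw [Bialgebra.comul_mul, hP.1, hQ.1, Algebra.TensorProduct.tmul_mul_tmul]
  · rw [Bialgebra.counit_mul, hP.2, hQ.2, one_mul]

theorem IsGrouplike.mul_isPrimitive {P Q a : A} (hP : IsGrouplike k P)
    (ha : IsPrimitive k Q a) : IsPrimitive k (P * Q) (P * a) := by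
  rw [IsPrimitive] at *
  rw [Bialgebra.comul_mul, hP.1, ha, mul_add, Algebra.TensorProduct.tmul_mul_tmul,
    Algebra.TensorProduct.tmul_mul_tmul]

/-- A linear image of a tensor product of submodules lands in `r` as soon as pure tensors do. -/
theorem map_mem_of_mem_map₂_mk {M : Type*} [AddCommGroup M] [Module k M]
    (φ : A ⊗[k] A →ₗ[k] M) {p q : Submodule k A} {r : Submodule k M}
    (h : ∀ a ∈ p, ∀ b ∈ q, φ (a ⊗ₜ b) ∈ r) {x : A ⊗[k] A}
    (hx : x ∈ map₂ (TensorProduct.mk k A A) p q) : φ x ∈ r :=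
  (map₂_le.2 h : map₂ (TensorProduct.mk k A A) p q ≤ r.comap φ) hx

theorem IsGrouplike.mul_mem_primFiltration {P Q : A} (hP : IsGrouplike k P) {n : ℕ} {a : A}
    (ha : a ∈ primFiltration k Q n) : P * a ∈ primFiltration k (P * Q) n := by
  induction n generalizing a with
  | zero =>
    obtain rfl : a = 0 := ha
    rw [mul_zero]; exact zero_mem _
  | succ n ih =>
    have key : reducedComul k (P * Q) (P * a) =
        LinearMap.mulLeft k (P ⊗ₜ[k] P) (reducedComul k Q a) := by
      simp [reducedComul_apply, Bialgebra.comul_mul, hP.1, mul_sub]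
    rw [mem_primFiltration_succ, key]
    refine map_mem_of_mem_map₂_mk _ (fun b hb c hc => ?_) ha
    rw [LinearMap.mulLeft_apply, Algebra.TensorProduct.tmul_mul_tmul]
    exact apply_mem_map₂ _ (ih hb) (ih hc)

theorem IsPrimitive.mul_mem_primFiltration {P Q x : A} (hP : IsGrouplike k P)
    (hQ : IsGrouplike k Q) (hcP : ∀ a, P * a = a * P) (hcQ : ∀ a, Q * a = a * Q)
    (hx : IsPrimitive k P x) {n : ℕ} {a : A} (ha : a ∈ primFiltration k Q n) :
    x * a ∈ primFiltration k (P * Q) (n + 1) := by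
  induction n generalizing a with
  | zero =>
    obtain rfl : a = 0 := ha
    rw [mul_zero]; exact zero_mem _
  | succ n ih =>
    have key : reducedComul k (P * Q) (x * a) =
        (x * Q) ⊗ₜ[k] (P * a) + (P * a) ⊗ₜ[k] (x * Q) +
        LinearMap.mulLeft k (x ⊗ₜ[k] P + P ⊗ₜ[k] x) (reducedComul k Q a) := by
      have hx' : Coalgebra.comul (R := k) x = x ⊗ₜ[k] P + P ⊗ₜ[k] x := hx
      simp only [reducedComul_apply, Bialgebra.comul_mul, hx', LinearMap.mulLeft_apply, mul_sub,
        add_mul, Algebra.TensorProduct.tmul_mul_tmul]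
      abel
    rw [mem_primFiltration_succ, key]
    have hxQ : x * Q ∈ primFiltration k (P * Q) (n + 1) := by
      rw [hcP Q, ← hcQ x]
      exact primFiltration_mono _ (by omega) (hQ.mul_isPrimitive hx).mem_primFiltration_one
    have hPa : P * a ∈ primFiltration k (P * Q) (n + 1) := hP.mul_mem_primFiltration ha
    refine add_mem (add_mem (apply_mem_map₂ _ hxQ hPa) (apply_mem_map₂ _ hPa hxQ)) ?_
    refine map_mem_of_mem_map₂_mk _ (fun b hb c hc => ?_) ha
    have hPF {d : A} (hd : d ∈ primFiltration k Q n) : P * d ∈ primFiltration k (P * Q) (n + 1) :=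
      primFiltration_mono _ n.le_succ (hP.mul_mem_primFiltration hd)
    rw [LinearMap.mulLeft_apply, add_mul, Algebra.TensorProduct.tmul_mul_tmul,
      Algebra.TensorProduct.tmul_mul_tmul]
    exact add_mem (apply_mem_map₂ _ (ih hb) (hPF hc)) (apply_mem_map₂ _ (hPF hb) (ih hc))

theorem counit_eq_zero_of_mem_primFiltration {Q : A} (hQ : IsGrouplike k Q) {n : ℕ} {a : A}
    (ha : a ∈ primFiltration k Q n) : Coalgebra.counit (R := k) a = 0 := by
  induction n generalizing a with
  | zero =>
    obtain rfl : a = 0 := ha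
    exact map_zero _
  | succ n ih =>
    have h := Coalgebra.rTensor_counit_comul (R := k) a
    have h0 : (Coalgebra.counit (R := k)).rTensor A (reducedComul k Q a) = 0 := by
      refine (mem_bot k).1 (map_mem_of_mem_map₂_mk _ (fun b hb c _ => ?_) ha)
      simp [ih hb]
    rw [comul_eq_reducedComul_add Q a, map_add, map_add, h0, zero_add, LinearMap.rTensor_tmul,
      LinearMap.rTensor_tmul, hQ.2, add_eq_right] at h
    simpa [hQ.2] using congrArg (Coalgebra.counit (R := k) ∘ TensorProduct.lid k A) h

/-- Contraction of the comultiplication against a functional in the second factor. -/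
noncomputable def comulContract (φ : A →ₗ[k] k) : Module.End k A :=
  (TensorProduct.rid k A).toLinearMap ∘ₗ φ.lTensor A ∘ₗ Coalgebra.comul

theorem comulContract_sub_apply (φ : A →ₗ[k] k) (Q a : A) :
    (comulContract φ - algebraMap k (Module.End k A) (φ Q)) a =
      (TensorProduct.rid k A).toLinearMap (φ.lTensor A (reducedComul k Q a)) + φ a • Q := by
  simp [comulContract, comul_eq_reducedComul_add Q a]
  abel

theorem mem_maxGenEigenspace_of_sub_mem {f : Module.End k A} {μ : k} {a : A}
    (h : (f - algebraMap k (Module.End k A) μ) a ∈ f.maxGenEigenspace μ) :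
    a ∈ f.maxGenEigenspace μ := by
  rw [Module.End.mem_maxGenEigenspace] at *
  obtain ⟨n, hn⟩ := h
  refine ⟨n + 1, ?_⟩
  rwa [pow_succ, Module.End.mul_apply]

theorem IsGrouplike.mem_maxGenEigenspace {Q : A} (hQ : IsGrouplike k Q) (φ : A →ₗ[k] k) :
    Q ∈ (comulContract φ).maxGenEigenspace (φ Q) := by
  apply mem_maxGenEigenspace_of_sub_mem
  simp [comulContract, hQ.1]

theorem primFiltration_le_maxGenEigenspace {Q : A} (hQ : IsGrouplike k Q) (φ : A →ₗ[k] k)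
    (n : ℕ) : primFiltration k Q n ≤ (comulContract φ).maxGenEigenspace (φ Q) := by
  induction n with
  | zero => exact bot_le
  | succ n ih =>
    intro a ha
    apply mem_maxGenEigenspace_of_sub_mem
    rw [comulContract_sub_apply]
    refine add_mem ?_ (smul_mem _ _ (hQ.mem_maxGenEigenspace φ))
    refine map_mem_of_mem_map₂_mk
      ((TensorProduct.rid k A).toLinearMap ∘ₗ φ.lTensor A) (fun b hb c _ => ?_) ha
    simpa using smul_mem _ (φ c) (ih hb)

variable (k) in
/-- The span of a grouplike `Q` and of the primitive filtration at `Q`. -/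
noncomputable def grouplikeComponent (Q : A) : Submodule k A :=
  k ∙ Q ⊔ ⨆ n, primFiltration k Q n

theorem mem_grouplikeComponent {Q a : A} :
    a ∈ grouplikeComponent k Q ↔ ∃ c : k, ∃ n, ∃ z ∈ primFiltration k Q n, c • Q + z = a := by
  rw [grouplikeComponent, mem_sup]
  constructor
  · rintro ⟨y, hy, z, hz, rfl⟩
    obtain ⟨c, rfl⟩ := mem_span_singleton.1 hy
    obtain ⟨n, hn⟩ := (mem_iSup_of_directed _ (primFiltration_mono Q).directed_le).1 hz
    exact ⟨c, n, z, hn, rfl⟩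
  · rintro ⟨c, n, z, hz, rfl⟩
    exact ⟨_, smul_mem _ c (mem_span_singleton_self Q), z, mem_iSup_of_mem n hz, rfl⟩

theorem grouplikeComponent_le_maxGenEigenspace {Q : A} (hQ : IsGrouplike k Q) (φ : A →ₗ[k] k) :
    grouplikeComponent k Q ≤ (comulContract φ).maxGenEigenspace (φ Q) :=
  sup_le ((span_singleton_le_iff_mem _ _).2 (hQ.mem_maxGenEigenspace φ))
    (iSup_le (primFiltration_le_maxGenEigenspace hQ φ))

theorem IsGrouplike.mul_mem_grouplikeComponent {P Q a : A} (hP : IsGrouplike k P)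
    (ha : a ∈ grouplikeComponent k Q) : P * a ∈ grouplikeComponent k (P * Q) := by
  obtain ⟨c, n, z, hz, rfl⟩ := mem_grouplikeComponent.1 ha
  exact mem_grouplikeComponent.2
    ⟨c, n, P * z, hP.mul_mem_primFiltration hz, by simp only [mul_add, mul_smul_comm]⟩

theorem IsPrimitive.mul_mem_grouplikeComponent {P Q x a : A} (hP : IsGrouplike k P)
    (hQ : IsGrouplike k Q) (hcP : ∀ a, P * a = a * P) (hcQ : ∀ a, Q * a = a * Q)
    (hx : IsPrimitive k P x) (ha : a ∈ grouplikeComponent k Q) :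
    x * a ∈ grouplikeComponent k (P * Q) := by
  obtain ⟨c, n, z, hz, rfl⟩ := mem_grouplikeComponent.1 ha
  refine mem_grouplikeComponent.2 ⟨0, n + 1, x * (c • Q + z), ?_, by simp⟩
  rw [mul_add, mul_smul_comm, ← hcQ x]
  refine add_mem (smul_mem _ _ ?_) (hx.mul_mem_primFiltration hP hQ hcP hcQ hz)
  rw [hcP Q]
  exact primFiltration_mono _ (by omega) (hQ.mul_isPrimitive hx).mem_primFiltration_one

/-- A generalized-primitively-generated rigid bialgebra is the sum of its components. -/
theorem RigidBialgebra.iSup_grouplikeComponent_eq_top {G : Type*} [CommMonoid G]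
    (R : RigidBialgebra k G A) (hgen : GPGenerated k A) :
    ⨆ g, grouplikeComponent k (R.η g) = ⊤ := by
  set V := ⨆ g, grouplikeComponent k (R.η g)
  have le (g : G) : grouplikeComponent k (R.η g) ≤ V :=
    le_iSup (fun g => grouplikeComponent k (R.η g)) g
  have stable {x : A} (h : ∀ g, ∀ a ∈ grouplikeComponent k (R.η g), x * a ∈ V) :
      ∀ a ∈ V, x * a ∈ V :=
    (iSup_le h : V ≤ V.comap (LinearMap.mulLeft k x))
  have hgp : genPrim k A ≤ (⨅ a : V, V.comap (LinearMap.mulRight k (a : A))) := by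
    refine span_le.2 ?_
    rintro x ⟨P, hP, hx⟩
    obtain ⟨g, rfl⟩ := R.surjOn P hP
    simp only [SetLike.mem_coe, mem_iInf, mem_comap, LinearMap.mulRight_apply, Subtype.forall]
    refine stable fun g' a ha => le (g * g') ?_
    rw [map_mul]
    exact hx.mul_mem_grouplikeComponent hP (R.grouplike g') (R.central g) (R.central g') ha
  have mul_mem (x : A) : ∀ a ∈ V, x * a ∈ V := by
    have hx : x ∈ Algebra.adjoin k ({a : A | IsGrouplike k a} ∪ (genPrim k A : Set A)) := by
      rw [GPGenerated] at hgen
      rw [hgen]; trivial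
    induction hx using Algebra.adjoin_induction with
    | mem x hx =>
      rcases hx with hx | hx
      · obtain ⟨g, rfl⟩ := R.surjOn x hx
        refine stable fun g' a ha => le (g * g') ?_
        rw [map_mul]
        exact hx.mul_mem_grouplikeComponent ha
      · intro a ha
        have := hgp hx
        simp only [mem_iInf, mem_comap, LinearMap.mulRight_apply, Subtype.forall] at this
        exact this a ha
    | algebraMap r =>
      intro a ha
      rw [← Algebra.smul_def]
      exact smul_mem _ _ ha
    | add x y _ _ hx hy =>
      intro a ha
      rw [add_mul]
      exact add_mem (hx a ha) (hy a ha)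
    | mul x y _ _ hx hy =>
      intro a ha
      rw [mul_assoc]
      exact hx _ (hy a ha)
  have one_mem : (1 : A) ∈ V := by
    refine le 1 (mem_grouplikeComponent.2 ⟨1, 0, 0, zero_mem _, ?_⟩)
    rw [map_one, one_smul, add_zero]
  exact eq_top_iff'.2 fun x => by simpa using mul_mem x 1 one_mem

theorem eq_zero_of_mem_map₂_of_map_eq_zero {M N : Type*} [AddCommGroup M] [Module k M] [AddCommGroup N]
    [Module k N] {f : M →ₗ[k] N} {p : Submodule k M} (hf : Set.InjOn f p) {x : M ⊗[k] M}
    (hx : x ∈ map₂ (TensorProduct.mk k M M) p p) (h : TensorProduct.map f f x = 0) : x = 0 := by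
  have hle : map₂ (TensorProduct.mk k M M) p p ≤
      LinearMap.range (TensorProduct.map p.subtype p.subtype) :=
    map₂_le.2 fun a ha b hb => ⟨⟨a, ha⟩ ⊗ₜ ⟨b, hb⟩, rfl⟩
  obtain ⟨y, rfl⟩ := hle hx
  have hinj : Function.Injective (f ∘ₗ p.subtype) := fun a b hab => Subtype.ext (hf a.2 b.2 hab)
  have hy : TensorProduct.map (f ∘ₗ p.subtype) (f ∘ₗ p.subtype) y = 0 := by
    rw [TensorProduct.map_comp]; exact h
  rw [(map_eq_zero_iff _ (TensorProduct.map_injective_of_flat_flat _ _ hinj hinj)).1 hy, map_zero]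

theorem injOn_primFiltration {f : A →ₐ[k] B} (hbi : IsBialgHom k f)
    (hinj : Set.InjOn f (genPrim k A)) {Q : A} (hQ : IsGrouplike k Q) (n : ℕ) :
    Set.InjOn f (primFiltration k Q n) := by
  have hker (n : ℕ) (h : ∀ z ∈ primFiltration k Q n, f z = 0 → z = 0) :
      Set.InjOn f (primFiltration k Q n) := fun a ha b hb hab =>
    sub_eq_zero.1 (h _ (sub_mem ha hb) (by rw [map_sub, hab, sub_self]))
  induction n with
  | zero => exact hker 0 fun z hz _ => hz
  | succ n ih =>
    refine hker _ fun z hz hfz => ?_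
    have hz' : reducedComul k Q z = 0 := by
      refine eq_zero_of_mem_map₂_of_map_eq_zero (f := f.toLinearMap) ih hz ?_
      simp [reducedComul_apply, ← hbi.1, hfz]
    have hmem : z ∈ genPrim k A :=
      subset_span ⟨Q, hQ, isPrimitive_iff_reducedComul_eq_zero.2 hz'⟩
    exact hinj hmem (zero_mem _) (by rw [hfz, map_zero])

theorem eq_zero_of_mem_grouplikeComponent {f : A →ₐ[k] B} (hbi : IsBialgHom k f)
    (hinj : Set.InjOn f (genPrim k A)) {Q a : A} (hQ : IsGrouplike k Q)
    (ha : a ∈ grouplikeComponent k Q) (hfa : f a = 0) : a = 0 := by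
  obtain ⟨c, n, z, hz, rfl⟩ := mem_grouplikeComponent.1 ha
  have hc := hbi.2 (c • Q + z)
  rw [hfa, map_zero, map_add, map_smul, hQ.2, counit_eq_zero_of_mem_primFiltration hQ hz,
    smul_eq_mul, mul_one, add_zero] at hc
  rw [← hc, zero_smul, zero_add] at hfa ⊢
  exact injOn_primFiltration hbi hinj hQ n hz (zero_mem _) (by rw [hfa, map_zero])

theorem map_mem_maxGenEigenspace {M N : Type*} [AddCommGroup M] [Module k M] [AddCommGroup N]
    [Module k N] {S : Module.End k M} {T : Module.End k N} {f : M →ₗ[k] N}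
    (h : ∀ a, f (S a) = T (f a)) {μ : k} {a : M} (ha : a ∈ S.maxGenEigenspace μ) :
    f a ∈ T.maxGenEigenspace μ := by
  rw [Module.End.mem_maxGenEigenspace] at *
  obtain ⟨n, hn⟩ := ha
  refine ⟨n, ?_⟩
  have hpow (m : ℕ) (b : M) : f (((S - μ • 1) ^ m) b) = ((T - μ • 1) ^ m) (f b) := by
    induction m generalizing b with
    | zero => rfl
    | succ m ih => simp [pow_succ, ih, h]
  rw [← hpow, hn, map_zero]

theorem map_comulContract {f : A →ₐ[k] B} (hbi : IsBialgHom k f) (φ : B →ₗ[k] k) (a : A) :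
    f (comulContract (φ ∘ₗ f.toLinearMap) a) = comulContract φ (f a) := by
  simp only [comulContract, LinearMap.comp_apply, hbi.1]
  generalize Coalgebra.comul (R := k) a = x
  induction x using TensorProduct.induction_on with
  | zero => simp
  | tmul a b => simp
  | add x y hx hy => simp only [map_add, hx, hy]

theorem RigidBialgebra.exists_dual {G : Type*} [CommMonoid G] (R : RigidBialgebra k G A)
    (g : G) : ∃ φ : A →ₗ[k] k, φ (R.η g) = 1 ∧ ∀ h ≠ g, φ (R.η h) = 0 := by
  classical
  have hli : LinearIndependent k R.η := by
    have hmem (g : G) : IsGroupLikeElem k (R.η g) := ⟨(R.grouplike g).2, (R.grouplike g).1⟩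
    exact (linearIndepOn_isGroupLikeElem (R := k) (A := A)).comp
      (fun g => (⟨R.η g, hmem g⟩ : {a : A | IsGroupLikeElem k a}))
      fun g h hgh => R.injective (congrArg Subtype.val hgh)
  obtain ⟨φ, hφ⟩ := LinearMap.exists_extend (Finsupp.lapply g ∘ₗ hli.repr)
  have hφ' (h : G) : φ (R.η h) = Finsupp.single h (1 : k) g := by
    rw [← hli.repr_eq_single h ⟨R.η h, subset_span ⟨h, rfl⟩⟩ rfl]
    exact LinearMap.congr_fun hφ ⟨R.η h, _⟩
  exact ⟨φ, by simp [hφ'], fun h hne => by simp [hφ', hne]⟩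

end PrimFiltration

/-- **Statement 4.** Let `A`, `B` be `G`-rigid `k`-bialgebras with `A`
generalized-primitively-generated, and let `f : A → B` be a morphism of `G`-rigid
`k`-bialgebras.  Then `f` is injective iff its restriction to the generalized primitives
is injective. -/
theorem rigid_injective_iff_injOn_genPrim (k G A B : Type*) [Field k] [CommMonoid G]
    [Ring A] [Bialgebra k A] [Ring B] [Bialgebra k B]
    (RA : RigidBialgebra k G A) (RB : RigidBialgebra k G B)
    (hgen : GPGenerated k A)
    (f : A →ₐ[k] B) (hbi : IsBialgHom k f) (hη : ∀ g : G, f (RA.η g) = RB.η g) :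
    Function.Injective f ↔ Set.InjOn f (genPrim k A) := by
  refine ⟨fun h => h.injOn, fun hinj => ?_⟩
  refine (injective_iff_map_eq_zero f).2 fun a hfa => ?_
  have ha : a ∈ ⨆ g, grouplikeComponent k (RA.η g) := by
    rw [RA.iSup_grouplikeComponent_eq_top hgen]; trivial
  obtain ⟨z, hz, rfl⟩ := (Submodule.mem_iSup_iff_exists_finsupp _ _).1 ha
  refine Finset.sum_eq_zero fun g hg => ?_
  refine eq_zero_of_mem_grouplikeComponent hbi hinj (RA.grouplike g) (hz g) ?_
  obtain ⟨φ, hφ, hφ'⟩ := RB.exists_dual g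
  have hmem (h : G) : f (z h) ∈ (comulContract φ).maxGenEigenspace (φ (RB.η h)) := by
    rw [← hη]
    exact map_mem_maxGenEigenspace (f := f.toLinearMap) (map_comulContract hbi φ)
      (grouplikeComponent_le_maxGenEigenspace (RA.grouplike h) (φ ∘ₗ f.toLinearMap) (hz h))
  have h1 := hmem g
  rw [hφ] at h1
  have h0 : f (z g) ∈ (comulContract φ).maxGenEigenspace 0 := by
    classical
    rw [Finsupp.sum, map_sum, ← Finset.add_sum_erase _ _ hg, add_eq_zero_iff_eq_neg] at hfa
    rw [hfa]
    refine neg_mem (sum_mem fun h hh => ?_)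
    rw [← hφ' h (Finset.ne_of_mem_erase hh)]
    exact hmem h
  exact Submodule.disjoint_def.1
    (Module.End.disjoint_genEigenspace (comulContract φ) one_ne_zero ⊤ ⊤) _ h1 h0
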